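/- For every n ≥ 1, the set G_n = {t_{k,n} : 1 ≤ k ≤ n} generates the symmetric group S_{f_{n+2}} on {1,...,f_{n+2}}. -/

import Mathlib

/-- The permutation `\hat t n = (1, f_{n+1}+1)(2, f_{n+1}+2)⋯(f_n, f_{n+1}+f_n)` of `ℕ`,
regarded as an element of the symmetric group on `{1,…,f_{n+2}}`. -/
def hatt (n : ℕ) : Equiv.Perm ℕ :=
  ((List.range (Nat.fib n)).map (fun i => Equiv.swap (i + 1) (Nat.fib (n + 1) + (i + 1)))).prod

/-- The permutations `t k n` of the paper, defined recursively by `t n n = \hat t n`,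
`t (n-1) n = t (n-1) (n-1)` and `t k n = t k (n-1) * (\hat t n * t k (n-2) * (\hat t n)⁻¹)`
for `k ≤ n - 2`. -/
def tperm (k : ℕ) : ℕ → Equiv.Perm ℕ
  | 0 => 1
  | 1 => hatt 1
  | (n + 2) =>
      if k = n + 2 then hatt (n + 2)
      else if k = n + 1 then tperm k (n + 1)
      else tperm k (n + 1) * (hatt (n + 2) * tperm k n * (hatt (n + 2))⁻¹)

/-- The symmetric group on `{1,…,m}`, as the subgroup of `Equiv.Perm ℕ` of permutations fixing
every point outside `{1,…,m}`. -/
def symOn (m : ℕ) : Subgroup (Equiv.Perm ℕ) where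
  carrier := {g | ∀ i ∉ Finset.Icc 1 m, g i = i}
  one_mem' := fun i _ => rfl
  mul_mem' := by
    intro a b ha hb i hi
    have := hb i hi
    have := ha i hi
    simp only [Equiv.Perm.mul_apply]
    rw [hb i hi, ha i hi]
  inv_mem' := by
    intro a ha i hi
    conv_lhs => rw [← ha i hi]
    simp

/-- The set `\tilde S_{f_n}`: elements `g` of the symmetric group on `{1,…,f_{n+2}}` such that
`g (i + f_{n+1}) = g i + f_{n+1}` for `1 ≤ i ≤ f_n` and `g i = i` for `f_n < i ≤ f_{n+1}`. -/
def tildeSet (n : ℕ) : Set (Equiv.Perm ℕ) :=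
  {g | (∀ i ∉ Finset.Icc 1 (Nat.fib (n + 2)), g i = i) ∧
    (∀ i ∈ Finset.Icc 1 (Nat.fib n), g (i + Nat.fib (n + 1)) = g i + Nat.fib (n + 1)) ∧
    (∀ i, Nat.fib n < i → i ≤ Nat.fib (n + 1) → g i = i)}

/-- The set `G_n = {t k n : 1 ≤ k ≤ n}`. -/
def Gset (n : ℕ) : Set (Equiv.Perm ℕ) := {σ | ∃ k, 1 ≤ k ∧ k ≤ n ∧ σ = tperm k n}

/-- The set `G'_n = {t k n : 1 ≤ k ≤ n - 2}`. -/
def G'set (n : ℕ) : Set (Equiv.Perm ℕ) := {σ | ∃ k, 1 ≤ k ∧ k ≤ n - 2 ∧ σ = tperm k n}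

open Equiv in
theorem prod_swap_apply (q r : ℕ) (hr : r ≤ q) (j : ℕ) :
    ((List.range r).map (fun i => swap (i + 1) (q + (i + 1)))).prod j =
      if 1 ≤ j ∧ j ≤ r then q + j else if q < j ∧ j ≤ q + r then j - q else j := by
  induction r generalizing j with
  | zero =>
    simp only [List.range_zero, List.map_nil, List.prod_nil, Perm.one_apply]
    split_ifs <;> omega
  | succ r ih =>
    rw [List.range_succ, List.map_append, List.prod_append, Perm.mul_apply]
    simp only [List.map_cons, List.map_nil, List.prod_cons, List.prod_nil, mul_one]
    rw [ih (by omega), swap_apply_def]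
    split_ifs <;> omega

theorem hatt_apply (n j : ℕ) :
    hatt n j = if 1 ≤ j ∧ j ≤ Nat.fib n then Nat.fib (n + 1) + j
      else if Nat.fib (n + 1) < j ∧ j ≤ Nat.fib (n + 1) + Nat.fib n then j - Nat.fib (n + 1)
      else j :=
  prod_swap_apply _ _ (Nat.fib_le_fib_succ) j

theorem hatt_mul_self (n : ℕ) : hatt n * hatt n = 1 := by
  ext j
  have h : Nat.fib n ≤ Nat.fib (n + 1) := Nat.fib_le_fib_succ
  rw [Equiv.Perm.mul_apply, hatt_apply, hatt_apply, Equiv.Perm.one_apply]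
  split_ifs <;> omega

theorem hatt_inv (n : ℕ) : (hatt n)⁻¹ = hatt n :=
  inv_eq_of_mul_eq_one_left (hatt_mul_self n)

theorem mem_symOn {m : ℕ} {g : Equiv.Perm ℕ} :
    g ∈ symOn m ↔ ∀ i, ¬ (1 ≤ i ∧ i ≤ m) → g i = i := by
  change (∀ i ∉ Finset.Icc 1 m, g i = i) ↔ _
  simp only [Finset.mem_Icc]

theorem symOn_mono {a b : ℕ} (h : a ≤ b) : symOn a ≤ symOn b := by
  intro g hg
  rw [mem_symOn] at *
  intro i hi
  exact hg i (by omega)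

theorem symOn_apply_mem {m : ℕ} {g : Equiv.Perm ℕ} (hg : g ∈ symOn m) {i : ℕ}
    (hi : 1 ≤ i ∧ i ≤ m) : 1 ≤ g i ∧ g i ≤ m := by
  by_contra h
  have := g.injective (mem_symOn.1 hg _ h)
  rw [this] at h
  exact h hi

theorem swap_mem_symOn {m a b : ℕ} (ha : 1 ≤ a ∧ a ≤ m) (hb : 1 ≤ b ∧ b ≤ m) :
    Equiv.swap a b ∈ symOn m := by
  rw [mem_symOn]
  intro i hi
  exact Equiv.swap_apply_of_ne_of_ne (by rintro rfl; exact hi ha) (by rintro rfl; exact hi hb)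

theorem hatt_mem_symOn (n : ℕ) : hatt n ∈ symOn (Nat.fib (n + 2)) := by
  rw [mem_symOn]
  intro i hi
  have h : Nat.fib (n + 2) = Nat.fib n + Nat.fib (n + 1) := Nat.fib_add_two
  rw [hatt_apply]
  split_ifs <;> omega

theorem tperm_mem_symOn (k : ℕ) : ∀ n, tperm k n ∈ symOn (Nat.fib (n + 2))
  | 0 => by rw [tperm]; exact one_mem _
  | 1 => by rw [tperm]; exact hatt_mem_symOn 1
  | n + 2 => by
    have h1 := symOn_mono (Nat.fib_le_fib_succ) (tperm_mem_symOn k (n + 1))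
    have h2 := symOn_mono (Nat.fib_mono (by omega : n + 2 ≤ n + 4)) (tperm_mem_symOn k n)
    have h3 := hatt_mem_symOn (n + 2)
    rw [tperm]
    split_ifs
    · exact h3
    · exact h1
    · exact mul_mem h1 (mul_mem (mul_mem h3 h2) (inv_mem h3))

theorem closure_Gset_le (n : ℕ) : Subgroup.closure (Gset n) ≤ symOn (Nat.fib (n + 2)) := by
  rw [Subgroup.closure_le]
  rintro _ ⟨k, -, -, rfl⟩
  exact tperm_mem_symOn k n

theorem tperm_self {n : ℕ} (hn : 1 ≤ n) : tperm n n = hatt n := by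
  obtain _ | _ | n := n
  · omega
  · rw [tperm]
  · rw [tperm, if_pos rfl]

theorem tperm_succ_self {n : ℕ} (hn : 1 ≤ n) : tperm n (n + 1) = hatt n := by
  obtain _ | n := n
  · omega
  · rw [tperm, if_neg (by omega), if_pos rfl, tperm_self hn]

theorem symOn_le_of_swap_mem {H : Subgroup (Equiv.Perm ℕ)} (m : ℕ)
    (h : ∀ a b, 1 ≤ a ∧ a ≤ m → 1 ≤ b ∧ b ≤ m → Equiv.swap a b ∈ H) : symOn m ≤ H := by
  induction m with
  | zero =>
    intro g hg
    rw [mem_symOn] at hg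
    have : g = 1 := Equiv.ext fun i => hg i (by omega)
    exact this ▸ one_mem H
  | succ m ih =>
    intro g hg
    have hm := symOn_apply_mem hg (i := m + 1) (by omega)
    have hs := h (m + 1) (g (m + 1)) (by omega) hm
    rw [← Subgroup.mul_mem_cancel_left H hs]
    refine ih (fun a b ha hb => h a b (by omega) (by omega)) (mem_symOn.2 fun i hi => ?_)
    rw [Equiv.Perm.mul_apply]
    rcases eq_or_ne i (m + 1) with rfl | hne
    · exact Equiv.swap_apply_right _ _
    · have hgi := mem_symOn.1 hg i (by omega)
      rw [hgi]
      refine Equiv.swap_apply_of_ne_of_ne hne fun hc => hne (g.injective ?_)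
      rw [hgi, hc]

theorem swap_eq_star (c a b : ℕ) (hb : b ≠ c) (hab : a ≠ b) :
    Equiv.swap a b = Equiv.swap c a * Equiv.swap c b * Equiv.swap c a := by
  rw [Equiv.swap_comm c b, Equiv.swap_mul_swap_mul_swap hb hab.symm]

theorem symOn_le_of_star_mem {H : Subgroup (Equiv.Perm ℕ)} {m : ℕ} (c : ℕ)
    (h : ∀ a, 1 ≤ a ∧ a ≤ m → Equiv.swap c a ∈ H) : symOn m ≤ H := by
  refine symOn_le_of_swap_mem m fun a b ha hb => ?_
  rcases eq_or_ne a b with rfl | hab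
  · rw [Equiv.swap_self]; exact one_mem H
  rcases eq_or_ne b c with rfl | hbc
  · rw [Equiv.swap_comm]; exact h a ha
  rw [swap_eq_star c a b hbc hab]
  exact mul_mem (mul_mem (h a ha) (h b hb)) (h a ha)

/-- If every product of the transposition `s` with a member of `l` lies in `H`, then so does
the product of `l` with the power of `s` of the same length. -/
theorem pow_mul_prod_mem {H : Subgroup (Equiv.Perm ℕ)} {s : Equiv.Perm ℕ} (hs : s * s = 1)
    (l : List (Equiv.Perm ℕ)) (hl : ∀ g ∈ l, s * g ∈ H ∧ g * s ∈ H) :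
    s ^ l.length * l.prod ∈ H := by
  induction l with
  | nil => simp
  | cons g l ih =>
    have ih := ih fun g hg => hl g (List.mem_cons_of_mem _ hg)
    obtain ⟨h1, h2⟩ := hl g List.mem_cons_self
    have hs' : s ^ 2 = 1 := by rw [pow_two, hs]
    rw [List.length_cons, List.prod_cons]
    rcases Nat.even_or_odd' l.length with ⟨k, hk | hk⟩
    · rw [hk, pow_mul, hs', one_pow, one_mul] at ih
      rw [hk, pow_succ, pow_mul, hs', one_pow, one_mul, ← mul_assoc]
      exact mul_mem h1 ih
    · rw [hk, pow_succ, pow_mul, hs', one_pow, one_mul] at ih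
      rw [hk, pow_succ, pow_succ, pow_mul, hs', one_pow, one_mul, hs, one_mul]
      have := mul_mem h2 ih
      rwa [mul_assoc, ← mul_assoc s s, hs, one_mul] at this

theorem symOn_le_of_star_mul_mem {H : Subgroup (Equiv.Perm ℕ)} {n : ℕ} (c d r : ℕ)
    (h : ∀ a, 1 ≤ a ∧ a ≤ n → a ≠ c → Equiv.swap c a * Equiv.swap c d ∈ H)
    (hr : Odd (Nat.fib r)) (hrn : Nat.fib (r + 2) ≤ n) (hH : hatt r ∈ H) : symOn n ≤ H := by
  set s := Equiv.swap c d with hs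
  have hss : s * s = 1 := Equiv.swap_mul_self c d
  have hsi : s⁻¹ = s := Equiv.swap_inv c d
  have h' : ∀ a, 1 ≤ a ∧ a ≤ n → a ≠ c → s * Equiv.swap c a ∈ H := fun a ha hac => by
    have := inv_mem (h a ha hac)
    rwa [mul_inv_rev, hsi, Equiv.swap_inv] at this
  have key : ∀ a b, 1 ≤ a ∧ a ≤ n → 1 ≤ b ∧ b ≤ n → a ≠ b →
      s * Equiv.swap a b ∈ H ∧ Equiv.swap a b * s ∈ H := fun a b ha hb hab => by
    have h1 : s * Equiv.swap a b ∈ H := by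
      rcases eq_or_ne a c with rfl | hac
      · exact h' b hb hab.symm
      rcases eq_or_ne b c with rfl | hbc
      · rw [Equiv.swap_comm]; exact h' a ha hac
      have := mul_mem (mul_mem (h' a ha hac) (h b hb hbc)) (h' a ha hac)
      rw [swap_eq_star c a b hbc hab]
      have e : s * Equiv.swap c a * (Equiv.swap c b * s) * (s * Equiv.swap c a) =
          s * (Equiv.swap c a * Equiv.swap c b * Equiv.swap c a) := by
        simp only [mul_assoc]
        rw [← mul_assoc s s, hss, one_mul]
      rwa [e] at this
    refine ⟨h1, ?_⟩
    have := inv_mem h1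
    rwa [mul_inv_rev, hsi, Equiv.swap_inv] at this
  have hsH : s ∈ H := by
    have hp := pow_mul_prod_mem (H := H) hss
      ((List.range (Nat.fib r)).map
        (fun i => Equiv.swap (i + 1) (Nat.fib (r + 1) + (i + 1)))) (by
        intro g hg
        obtain ⟨i, hi, rfl⟩ := List.mem_map.1 hg
        rw [List.mem_range] at hi
        have h1 : Nat.fib r ≤ Nat.fib (r + 1) := Nat.fib_le_fib_succ
        have h2 : Nat.fib (r + 2) = Nat.fib r + Nat.fib (r + 1) := Nat.fib_add_two
        exact key _ _ (by omega) (by omega) (by omega))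
    rw [List.length_map, List.length_range] at hp
    obtain ⟨k, hk⟩ := hr
    have e : s ^ Nat.fib r = s := by
      rw [hk, pow_succ, pow_mul, pow_two, hss, one_pow, one_mul]
    rw [e] at hp
    exact (Subgroup.mul_mem_cancel_right H hH).1 hp
  refine symOn_le_of_star_mem c fun a ha => ?_
  rcases eq_or_ne a c with rfl | hac
  · rw [Equiv.swap_self]; exact one_mem H
  · exact (Subgroup.mul_mem_cancel_right H hsH).1 (h a ha hac)

theorem exists_mem_symOn_triple {m p q r p' q' r' : ℕ}
    (hp : 1 ≤ p ∧ p ≤ m) (hq : 1 ≤ q ∧ q ≤ m) (hr : 1 ≤ r ∧ r ≤ m)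
    (hp' : 1 ≤ p' ∧ p' ≤ m) (hq' : 1 ≤ q' ∧ q' ≤ m) (hr' : 1 ≤ r' ∧ r' ≤ m)
    (hpq : p ≠ q) (hpr : p ≠ r) (hqr : q ≠ r) (hpq' : p' ≠ q') (hpr' : p' ≠ r') (hqr' : q' ≠ r') :
    ∃ u ∈ symOn m, u p = p' ∧ u q = q' ∧ u r = r' := by
  have m1 := swap_mem_symOn hp hp'
  have m2 := mul_mem (swap_mem_symOn (symOn_apply_mem m1 hq) hq') m1
  have m3 := mul_mem (swap_mem_symOn (symOn_apply_mem m2 hr) hr') m2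
  refine ⟨_, m3, ?_, ?_, ?_⟩ <;> simp only [Equiv.Perm.mul_apply, Equiv.swap_apply_def] <;> grind

/-- Conjugation by a permutation of the first block, when that symmetric group is generated by
the previous `Gset`, is realised inside `closure (Gset (m + 2))`. -/
theorem conj_mem_closure {m : ℕ}
    (ih : Subgroup.closure (Gset (m + 1)) = symOn (Nat.fib (m + 3)))
    {u z : Equiv.Perm ℕ} (hu : u ∈ symOn (Nat.fib (m + 3))) (hz : z ∈ symOn (Nat.fib (m + 3)))
    (hzH : z ∈ Subgroup.closure (Gset (m + 2))) :
    u * z * u⁻¹ ∈ Subgroup.closure (Gset (m + 2)) := by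
  set H := Subgroup.closure (Gset (m + 2)) with hH
  set Z := H ⊓ symOn (Nat.fib (m + 3)) with hZ
  suffices hle : Subgroup.closure (Gset (m + 1)) ≤ Subgroup.normalizer (Z : Set (Equiv.Perm ℕ)) by
    exact ((Subgroup.mem_normalizer_iff.1 (hle (ih ▸ hu)) z).1 ⟨hzH, hz⟩).1
  rw [Subgroup.closure_le]
  rintro _ ⟨k, hk1, hk2, rfl⟩
  have htH : tperm k (m + 2) ∈ H := Subgroup.subset_closure ⟨k, hk1, by omega, rfl⟩
  have hv : tperm k (m + 1) ∈ symOn (Nat.fib (m + 3)) := tperm_mem_symOn k (m + 1)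
  have hconj : ∀ z ∈ symOn (Nat.fib (m + 3)),
      tperm k (m + 2) * z * (tperm k (m + 2))⁻¹ = tperm k (m + 1) * z * (tperm k (m + 1))⁻¹ := by
    intro z hz
    rw [tperm, if_neg (by omega)]
    split_ifs with hk
    · rfl
    set w := hatt (m + 2) * tperm k m * (hatt (m + 2))⁻¹ with hw
    have hwz : w * z * w⁻¹ = z := by
      have hw1 : ∀ i, i ≤ Nat.fib (m + 3) → w i = i := by
        intro i hi
        rw [hw, Equiv.Perm.mul_apply, Equiv.Perm.mul_apply, hatt_inv,
          mem_symOn.1 (tperm_mem_symOn k m), ← Equiv.Perm.mul_apply, hatt_mul_self,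
          Equiv.Perm.one_apply]
        · have h0 : Nat.fib (m + 2 + 1) = Nat.fib (m + 3) := rfl
          have h1 : Nat.fib (m + 2) ≤ Nat.fib (m + 3) := Nat.fib_le_fib_succ
          rw [hatt_apply]
          split_ifs <;> omega
      have hd : Equiv.Perm.Disjoint w z := by
        intro i
        rcases le_or_gt i (Nat.fib (m + 3)) with hi | hi
        · exact Or.inl (hw1 i hi)
        · exact Or.inr (mem_symOn.1 hz i (by omega))
      rw [hd.commute.eq, mul_inv_cancel_right]
    calc tperm k (m + 1) * w * z * (tperm k (m + 1) * w)⁻¹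
        = tperm k (m + 1) * (w * z * w⁻¹) * (tperm k (m + 1))⁻¹ := by group
      _ = _ := by rw [hwz]
  rw [SetLike.mem_coe, Subgroup.mem_normalizer_iff]
  intro z
  have hS : z ∈ symOn (Nat.fib (m + 3)) ↔
      tperm k (m + 1) * z * (tperm k (m + 1))⁻¹ ∈ symOn (Nat.fib (m + 3)) := by
    rw [Subgroup.mul_mem_cancel_right _ (inv_mem hv), Subgroup.mul_mem_cancel_left _ hv]
  rw [hZ, Subgroup.mem_inf, Subgroup.mem_inf, ← hS]
  refine and_congr_left fun hz => ?_
  rw [← hconj z hz, Subgroup.mul_mem_cancel_right _ (inv_mem htH),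
    Subgroup.mul_mem_cancel_left _ htH]

theorem conj_swap_mul_swap (u : Equiv.Perm ℕ) (p q r : ℕ) :
    u * (Equiv.swap p q * Equiv.swap p r) * u⁻¹ =
      Equiv.swap (u p) (u q) * Equiv.swap (u p) (u r) := by
  rw [Equiv.swap_apply_apply, Equiv.swap_apply_apply]
  group

theorem symOn_le_closure_Gset_add_two {m : ℕ} (hm : 2 ≤ m)
    (ih : Subgroup.closure (Gset (m + 1)) = symOn (Nat.fib (m + 3))) :
    symOn (Nat.fib (m + 4)) ≤ Subgroup.closure (Gset (m + 2)) := by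
  set H := Subgroup.closure (Gset (m + 2)) with hH
  have hx : hatt (m + 1) ∈ H := Subgroup.subset_closure
    ⟨m + 1, by omega, by omega, (tperm_succ_self (by omega)).symm⟩
  have hy : hatt (m + 2) ∈ H := Subgroup.subset_closure
    ⟨m + 2, by omega, le_rfl, (tperm_self (by omega)).symm⟩
  have hxS : hatt (m + 1) ∈ symOn (Nat.fib (m + 3)) := hatt_mem_symOn (m + 1)
  have f0 : 1 ≤ Nat.fib m := Nat.fib_pos.2 (by omega)
  have f1 : 2 ≤ Nat.fib (m + 1) := Nat.fib_mono (by omega : 3 ≤ m + 1)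
  have f2 : Nat.fib (m + 2) = Nat.fib m + Nat.fib (m + 1) := Nat.fib_add_two
  have f3 : Nat.fib (m + 3) = Nat.fib (m + 1) + Nat.fib (m + 2) := Nat.fib_add_two
  have f4 : Nat.fib (m + 4) = Nat.fib (m + 2) + Nat.fib (m + 3) := Nat.fib_add_two
  set b := Nat.fib (m + 1) + 1 with hb
  set e := Nat.fib (m + 2) + 1 with he
  have e1 : Nat.fib (m + 1 + 1) = Nat.fib (m + 2) := rfl
  have hx1 : hatt (m + 1) 1 = e := by rw [hatt_apply, if_pos (by omega)]
  have hxb : hatt (m + 1) b = b := by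
    rw [hatt_apply, if_neg (by omega), if_neg (by omega)]
  have base : Equiv.swap b 1 * Equiv.swap b e ∈ H := by
    have h := conj_mem_closure ih
      (swap_mem_symOn (a := b) (b := 1) (m := Nat.fib (m + 3)) (by omega) (by omega)) hxS hx
    have h2 := mul_mem h (inv_mem hx)
    rw [← hH, Equiv.swap_inv, mul_assoc, mul_assoc, ← mul_assoc (hatt (m + 1)),
      ← Equiv.swap_apply_apply, hx1, hxb] at h2
    exact h2
  have baseS : Equiv.swap b 1 * Equiv.swap b e ∈ symOn (Nat.fib (m + 3)) :=
    mul_mem (swap_mem_symOn (by omega) (by omega)) (swap_mem_symOn (by omega) (by omega))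
  set c := Nat.fib (m + 3) with hc
  have e2 : Nat.fib (m + 1 + 2) = c := rfl
  have e3 : Nat.fib (m + 2 + 1) = c := rfl
  have block : ∀ a, 1 ≤ a ∧ a ≤ c → a ≠ c → Equiv.swap c a * Equiv.swap c e ∈ H := by
    intro a ha hac
    rcases eq_or_ne a e with rfl | hae
    · rw [Equiv.swap_mul_self]; exact one_mem H
    obtain ⟨u, hu, u1, u2, u3⟩ := exists_mem_symOn_triple (m := c) (p := b) (q := 1) (r := e)
      (p' := c) (q' := a) (r' := e) (by omega) (by omega) (by omega) (by omega) ha (by omega)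
      (by omega) (by omega) (by omega) hac.symm (by omega) hae
    have := conj_mem_closure ih hu baseS base
    rwa [conj_swap_mul_swap, u1, u2, u3] at this
  have star : ∀ a, 1 ≤ a ∧ a ≤ Nat.fib (m + 4) → a ≠ c →
      Equiv.swap c a * Equiv.swap c e ∈ H := by
    intro a ha hac
    rcases le_or_gt a c with h | h
    · exact block a ⟨ha.1, h⟩ hac
    have h1 := block (a - c) (by omega) (by omega)
    have h2 := mul_mem (mul_mem hy h1) (inv_mem hy)
    have y1 : hatt (m + 2) c = c := by
      rw [hatt_apply, if_neg (by omega), if_neg (by omega)]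
    have y2 : hatt (m + 2) e = e := by
      rw [hatt_apply, if_neg (by omega), if_neg (by omega)]
    have y3 : hatt (m + 2) (a - c) = a := by
      rw [hatt_apply, if_pos (by omega)]
      omega
    rwa [conj_swap_mul_swap, y1, y2, y3] at h2
  rcases Nat.even_or_odd (Nat.fib (m + 1)) with h | h
  · refine symOn_le_of_star_mul_mem c e (m + 2) star ?_ le_rfl hy
    have hcop : Nat.Coprime (Nat.fib (m + 1)) (Nat.fib (m + 2)) := Nat.fib_coprime_fib_succ _
    rw [← Nat.not_even_iff_odd]
    intro h'
    have := Nat.dvd_gcd h.two_dvd h'.two_dvd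
    rw [hcop] at this
    omega
  · exact symOn_le_of_star_mul_mem c e (m + 1) star h (by omega) hx

theorem hatt_one : hatt 1 = Equiv.swap 1 2 := by simp [hatt]

theorem hatt_two : hatt 2 = Equiv.swap 1 3 := by simp [hatt, Nat.fib_add_two]

theorem symOn_le_closure_Gset_one : symOn 2 ≤ Subgroup.closure (Gset 1) := by
  refine symOn_le_of_star_mem 1 fun a ha => ?_
  obtain rfl | rfl : a = 1 ∨ a = 2 := by omega
  · rw [Equiv.swap_self]; exact one_mem _
  · exact Subgroup.subset_closure ⟨1, le_rfl, le_rfl, by rw [tperm_self le_rfl, hatt_one]⟩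

theorem symOn_le_closure_Gset_two : symOn 3 ≤ Subgroup.closure (Gset 2) := by
  refine symOn_le_of_star_mem 1 fun a ha => ?_
  obtain rfl | rfl | rfl : a = 1 ∨ a = 2 ∨ a = 3 := by omega
  · rw [Equiv.swap_self]; exact one_mem _
  · exact Subgroup.subset_closure
      ⟨1, le_rfl, by omega, by rw [tperm_succ_self le_rfl, hatt_one]⟩
  · exact Subgroup.subset_closure
      ⟨2, by omega, le_rfl, by rw [tperm_self (by omega), hatt_two]⟩

theorem symOn_le_closure_Gset_three : symOn 5 ≤ Subgroup.closure (Gset 3) := by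
  set H := Subgroup.closure (Gset 3) with hH
  have hx : Equiv.swap 3 1 ∈ H := Subgroup.subset_closure
    ⟨2, by omega, by omega, by rw [tperm_succ_self (by omega), hatt_two, Equiv.swap_comm]⟩
  have hy : hatt 3 ∈ H := Subgroup.subset_closure
    ⟨3, by omega, le_rfl, (tperm_self (by omega)).symm⟩
  have ht : tperm 1 3 ∈ H := Subgroup.subset_closure ⟨1, le_rfl, by omega, rfl⟩
  have hval : tperm 1 3 = Equiv.swap 1 2 * (hatt 3 * Equiv.swap 1 2 * (hatt 3)⁻¹) := by
    rw [tperm, if_neg (by omega), if_neg (by omega), tperm_succ_self le_rfl, tperm_self le_rfl,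
      hatt_one]
  rw [← Equiv.swap_apply_apply] at hval
  have y1 : hatt 3 1 = 4 := by rw [hatt_apply]; rfl
  have y2 : hatt 3 2 = 5 := by rw [hatt_apply]; rfl
  have y3 : hatt 3 3 = 3 := by rw [hatt_apply]; rfl
  rw [y1, y2] at hval
  have h2 : Equiv.swap 3 2 ∈ H := by
    have := mul_mem (mul_mem ht hx) (inv_mem ht)
    rw [← Equiv.swap_apply_apply, hval] at this
    exact this
  have conj : ∀ a, Equiv.swap 3 a ∈ H → Equiv.swap 3 (hatt 3 a) ∈ H := fun a ha => by
    have := mul_mem (mul_mem hy ha) (inv_mem hy)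
    rwa [← Equiv.swap_apply_apply, y3] at this
  refine symOn_le_of_star_mem 3 fun a ha => ?_
  obtain rfl | rfl | rfl | rfl | rfl : a = 1 ∨ a = 2 ∨ a = 3 ∨ a = 4 ∨ a = 5 := by omega
  · exact hx
  · exact h2
  · rw [Equiv.swap_self]; exact one_mem _
  · exact y1 ▸ conj 1 hx
  · exact y2 ▸ conj 2 h2

/-- For every `n ≥ 1`, the set `G_n = {t k n : 1 ≤ k ≤ n}` generates the
symmetric group on `{1,…,f_{n+2}}`. -/
theorem closure_Gset (n : ℕ) (hn : 1 ≤ n) :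
    Subgroup.closure (Gset n) = symOn (Nat.fib (n + 2)) := by
  refine le_antisymm (closure_Gset_le n) ?_
  induction n, hn using Nat.le_induction with
  | base => exact symOn_le_closure_Gset_one
  | succ n hn ih =>
    obtain rfl | rfl | h : n = 1 ∨ n = 2 ∨ 3 ≤ n := by omega
    · exact symOn_le_closure_Gset_two
    · exact symOn_le_closure_Gset_three
    · obtain ⟨m, rfl⟩ : ∃ m, n = m + 1 := ⟨n - 1, by omega⟩
      exact symOn_le_closure_Gset_add_two (by omega) (le_antisymm (closure_Gset_le _) ih)
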